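/- Let ψ ∈ L²([-π,π]) be a unit vector with Fourier coefficients ψ̂(n) = (2π)^{-1/2}∫_{-π}^{π} e^{-inθ}ψ(θ)dθ. Then for every a > 0: ∑_{n∈ℤ} n² |ψ̂(n)|² + [a(8a² + 5a + 2)/(8a + 4)] · ∫_{-π}^{π} 2(1 − cos θ)|ψ(θ)|² dθ ≥ a. This family of bounds is strictly better, after optimization over a, than the Carruthers–Nieto tradeoff. -/

import Mathlib

open MeasureTheory Real

/-- Pointwise inequality behind the second-order trial function: with `h = φ'/φ` and
`h' = dh/dθ`, one has `-(h' + h²) + 2μ(1 - cos θ) ≥ a`. -/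
lemma second_order_potential_bound {a : ℝ} (ha : 0 < a) {b : ℝ} (hb : b * (8 * a + 4) = -a ^ 2)
    {c s : ℝ} (hcs : s ^ 2 + c ^ 2 = 1) :
    a ≤ (a - 2 * b) * c + 2 * b * (c ^ 2 - s ^ 2) - (((a - 2 * b) + 2 * b * c) * s) ^ 2
      + (a * (8 * a ^ 2 + 5 * a + 2) / (8 * a + 4)) * (2 * (1 - c)) := by
  have hμ : a * (8 * a ^ 2 + 5 * a + 2) / (8 * a + 4) = (a + 6 * b + 2 * a ^ 2) / 2 := by
    field_simp
    linear_combination (-6) * hb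
  have hb0 : b ≤ 0 := by
    by_contra! h
    nlinarith [mul_pos h ha, sq_nonneg a]
  have hab : 0 ≤ a + 2 * b := by
    by_contra! h
    nlinarith [mul_pos ha ha]
  have hc : 0 ≤ 1 - c := by nlinarith [sq_nonneg s, sq_nonneg (c - 1)]
  have hs : s ^ 2 = 1 - c ^ 2 := by linarith
  have h1 : 0 ≤ -b * (a + 2 * b) * (1 - c) ^ 3 :=
    mul_nonneg (mul_nonneg (by linarith) hab) (pow_nonneg hc 3)
  have h2 : 0 ≤ b ^ 2 * (1 - c) ^ 4 := by positivity
  rw [hμ, mul_pow, hs]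
  linear_combination 4 * h1 + 4 * h2 - (1 - c) ^ 2 * hb

/-- The second-order uncertainty bound for differentiable functions, in terms of the derivative. -/
lemma second_order_bound_of_hasDerivAt {a : ℝ} (ha : 0 < a) {P P' : ℝ → ℂ}
    (hP : ∀ θ, HasDerivAt P (P' θ) θ) (hP' : Continuous P') :
    a * (∫ θ in (-π)..π, ‖P θ‖ ^ 2) ≤ (∫ θ in (-π)..π, ‖P' θ‖ ^ 2)
      + (a * (8 * a ^ 2 + 5 * a + 2) / (8 * a + 4))
        * ∫ θ in (-π)..π, 2 * (1 - Real.cos θ) * ‖P θ‖ ^ 2 := by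
  set μ := a * (8 * a ^ 2 + 5 * a + 2) / (8 * a + 4) with hμ
  obtain ⟨b, hb⟩ : ∃ b : ℝ, b * (8 * a + 4) = -a ^ 2 :=
    ⟨-a ^ 2 / (8 * a + 4), by field_simp⟩
  have hPc : Continuous P := continuous_iff_continuousAt.2 fun θ => (hP θ).continuousAt
  let h : ℝ → ℝ := fun θ => -(((a - 2 * b) + 2 * b * cos θ) * sin θ)
  let h' : ℝ → ℝ := fun θ => -((a - 2 * b) * cos θ + 2 * b * (cos θ ^ 2 - sin θ ^ 2))
  have hh : ∀ θ, HasDerivAt h (h' θ) θ := fun θ => by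
    have := ((((hasDerivAt_cos θ).const_mul (2 * b)).const_add (a - 2 * b)).mul
      (hasDerivAt_sin θ)).neg
    refine this.congr_deriv ?_
    simp only [h']
    ring
  let D : ℝ → ℝ := fun θ => h' θ * ‖P θ‖ ^ 2 + h θ * (2 * inner ℝ (P θ) (P' θ))
  have hD : ∀ θ, HasDerivAt (fun θ => h θ * ‖P θ‖ ^ 2) (D θ) θ := fun θ =>
    (hh θ).mul (hP θ).norm_sq
  have hDc : Continuous D := by fun_prop
  have hD0 : ∫ θ in (-π)..π, D θ = 0 := by
    rw [intervalIntegral.integral_eq_sub_of_hasDerivAt (fun θ _ => hD θ)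
      (hDc.intervalIntegrable _ _)]
    simp [h]
  have key : ∀ θ, a * ‖P θ‖ ^ 2 + D θ ≤ ‖P' θ‖ ^ 2 + μ * (2 * (1 - cos θ) * ‖P θ‖ ^ 2) := by
    intro θ
    have h1 := mul_le_mul_of_nonneg_right
      (second_order_potential_bound ha hb (sin_sq_add_cos_sq θ)) (sq_nonneg ‖P θ‖)
    have h2 : 0 ≤ ‖P' θ‖ ^ 2 - 2 * h θ * inner ℝ (P θ) (P' θ) + h θ ^ 2 * ‖P θ‖ ^ 2 := by
      have := norm_sub_sq_real (P' θ) (h θ • P θ)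
      rw [inner_smul_right, norm_smul, mul_pow, Real.norm_eq_abs, sq_abs,
        real_inner_comm] at this
      nlinarith [sq_nonneg ‖P' θ - h θ • P θ‖]
    rw [← hμ] at h1
    simp only [D, h, h'] at h2 ⊢
    linarith
  clear_value D
  have hmono := intervalIntegral.integral_mono_on (μ := volume) (a := -π) (b := π)
    (by linarith [pi_pos])
    (Continuous.intervalIntegrable (by fun_prop) _ _)
    (Continuous.intervalIntegrable (by fun_prop) _ _) (fun θ _ => key θ)
  rw [intervalIntegral.integral_add (Continuous.intervalIntegrable (by fun_prop) _ _)
      (hDc.intervalIntegrable _ _),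
    intervalIntegral.integral_add (Continuous.intervalIntegrable (by fun_prop) _ _)
      (Continuous.intervalIntegrable (by fun_prop) _ _),
    intervalIntegral.integral_const_mul, intervalIntegral.integral_const_mul, hD0] at hmono
  linarith

/-- The unitarily normalized Fourier coefficients on `[-π, π]`. -/
noncomputable def unitaryFourierCoeff (f : ℝ → ℂ) (n : ℤ) : ℂ :=
  (Real.sqrt (2 * π) : ℂ)⁻¹ * ∫ θ in (-π)..π, Complex.exp (-(n : ℂ) * θ * Complex.I) * f θ

/-- The trigonometric polynomial with unitarily normalized Fourier coefficients `x n`, `n ∈ s`. -/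
noncomputable def trigPoly (s : Finset ℤ) (x : ℤ → ℂ) (θ : ℝ) : ℂ :=
  ∑ n ∈ s, x n * ((Real.sqrt (2 * π) : ℂ)⁻¹ * Complex.exp ((n : ℂ) * θ * Complex.I))

lemma continuous_trigPoly (s : Finset ℤ) (x : ℤ → ℂ) : Continuous (trigPoly s x) := by
  unfold trigPoly
  fun_prop

lemma hasDerivAt_trigPoly (s : Finset ℤ) (x : ℤ → ℂ) (θ : ℝ) :
    HasDerivAt (trigPoly s x) (trigPoly s (fun n => n * Complex.I * x n) θ) θ := by
  unfold trigPoly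
  refine HasDerivAt.fun_sum fun n _ => ?_
  have h := (((((hasDerivAt_id θ).ofReal_comp).const_mul (n : ℂ)).mul_const Complex.I).cexp.const_mul
    (Real.sqrt (2 * π) : ℂ)⁻¹).const_mul (x n)
  refine h.congr_deriv ?_
  simp only [id, Complex.ofReal_one]
  ring

lemma integral_exp_int_mul_I (k : ℤ) :
    ∫ θ in (-π)..π, Complex.exp ((k : ℂ) * θ * Complex.I) = if k = 0 then 2 * (π : ℂ) else 0 := by
  split_ifs with hk
  · simp [hk]
    ring
  · have hc : (k : ℂ) * Complex.I ≠ 0 := by simp [hk]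
    simp_rw [mul_right_comm (k : ℂ) _ Complex.I]
    rw [integral_exp_mul_complex hc, div_eq_zero_iff, sub_eq_zero]
    left
    rw [Complex.exp_eq_exp_iff_exists_int]
    exact ⟨k, by push_cast; ring⟩

lemma sqrt_two_pi_inv_mul_self :
    (Real.sqrt (2 * π) : ℂ)⁻¹ * (Real.sqrt (2 * π) : ℂ)⁻¹ = (2 * (π : ℂ))⁻¹ := by
  rw [← mul_inv, ← Complex.ofReal_mul, Real.mul_self_sqrt (by positivity)]
  push_cast
  rfl

lemma unitaryFourierCoeff_trigPoly (s : Finset ℤ) (x : ℤ → ℂ) (n : ℤ) :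
    unitaryFourierCoeff (trigPoly s x) n = if n ∈ s then x n else 0 := by
  have hterm : ∀ (m : ℤ) (θ : ℝ), Complex.exp (-(n : ℂ) * θ * Complex.I)
      * (x m * ((Real.sqrt (2 * π) : ℂ)⁻¹ * Complex.exp ((m : ℂ) * θ * Complex.I)))
      = (x m * (Real.sqrt (2 * π) : ℂ)⁻¹) * Complex.exp (((m - n : ℤ) : ℂ) * θ * Complex.I) := by
    intro m θ
    have : (((m - n : ℤ) : ℂ) * θ * Complex.I)
        = -(n : ℂ) * θ * Complex.I + (m : ℂ) * θ * Complex.I := by push_cast; ring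
    rw [this, Complex.exp_add]
    ring
  unfold unitaryFourierCoeff trigPoly
  simp_rw [Finset.mul_sum, hterm]
  rw [intervalIntegral.integral_finsetSum
    fun m _ => Continuous.intervalIntegrable (by fun_prop) _ _]
  simp_rw [intervalIntegral.integral_const_mul, integral_exp_int_mul_I, sub_eq_zero, mul_ite,
    mul_zero, Finset.sum_ite_eq']
  split_ifs
  · have h := sqrt_two_pi_inv_mul_self
    have hπ : (2 * (π : ℂ)) ≠ 0 := by simp [pi_ne_zero]
    linear_combination (x n * (2 * π)) * h + x n * inv_mul_cancel₀ hπ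
  · simp

lemma hasSum_sq_unitaryFourierCoeff {f : ℝ → ℂ}
    (hf : MemLp f 2 (volume.restrict (Set.Ioc (-π) π))) :
    HasSum (fun n => ‖unitaryFourierCoeff f n‖ ^ 2) (∫ θ in (-π)..π, ‖f θ‖ ^ 2) := by
  have hlt : -π < π := by linarith [pi_pos]
  have h := (hasSum_sq_fourierCoeffOn hlt hf).mul_left (2 * π)
  convert! h using 1
  · funext n
    have hcoeff : unitaryFourierCoeff f n = (Real.sqrt (2 * π) : ℂ) * fourierCoeffOn hlt f n := by
      have hπ : (Real.sqrt (2 * π) : ℂ) ≠ 0 := by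
        exact_mod_cast (Real.sqrt_pos.2 (by positivity : (0 : ℝ) < 2 * π)).ne'
      rw [fourierCoeffOn_eq_integral, unitaryFourierCoeff, Complex.real_smul, ← mul_assoc]
      congr 1
      · have h1 := sqrt_two_pi_inv_mul_self
        have h2 : ((1 / (π - -π) : ℝ) : ℂ) = (2 * (π : ℂ))⁻¹ := by
          push_cast
          rw [one_div]
          congr 1
          ring
        rw [h2, ← h1, mul_inv_cancel_left₀ hπ]
      · refine intervalIntegral.integral_congr fun θ _ => ?_
        simp only [fourier_coe_apply, smul_eq_mul]
        congr 2
        have : (π : ℂ) ≠ 0 := by exact_mod_cast pi_ne_zero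
        push_cast
        field_simp
        ring
    rw [hcoeff, norm_mul, mul_pow, Complex.norm_real, Real.norm_eq_abs, sq_abs,
      Real.sq_sqrt (by positivity)]
  · rw [smul_eq_mul, ← mul_assoc, sub_neg_eq_add, ← two_mul, mul_inv_cancel₀ (by positivity),
      one_mul]

lemma memLp_trigPoly (s : Finset ℤ) (x : ℤ → ℂ) :
    MemLp (trigPoly s x) 2 (volume.restrict (Set.Ioc (-π) π)) := by
  rw [memLp_two_iff_integrable_sq_norm (continuous_trigPoly s x).aestronglyMeasurable]
  exact ((continuous_trigPoly s x).norm.pow 2).integrableOn_Ioc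

lemma integral_norm_sq_trigPoly (s : Finset ℤ) (x : ℤ → ℂ) :
    ∫ θ in (-π)..π, ‖trigPoly s x θ‖ ^ 2 = ∑ n ∈ s, ‖x n‖ ^ 2 := by
  have h := hasSum_sq_unitaryFourierCoeff (memLp_trigPoly s x)
  refine h.unique ?_
  have h' := hasSum_sum_of_ne_finset_zero (s := s) (L := .unconditional ℤ)
    (f := fun n => ‖unitaryFourierCoeff (trigPoly s x) n‖ ^ 2)
    (fun n hn => by simp [unitaryFourierCoeff_trigPoly, hn])
  convert! h' using 1
  exact Finset.sum_congr rfl fun n hn => by simp [unitaryFourierCoeff_trigPoly, hn]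

lemma unitaryFourierCoeff_sub {f g : ℝ → ℂ}
    (hf : MemLp f 2 (volume.restrict (Set.Ioc (-π) π)))
    (hg : MemLp g 2 (volume.restrict (Set.Ioc (-π) π))) (n : ℤ) :
    unitaryFourierCoeff (f - g) n = unitaryFourierCoeff f n - unitaryFourierCoeff g n := by
  have hint : ∀ {u : ℝ → ℂ}, MemLp u 2 (volume.restrict (Set.Ioc (-π) π)) →
      IntervalIntegrable (fun θ : ℝ => Complex.exp (-(n : ℂ) * θ * Complex.I) * u θ)
        volume (-π) π := fun {u} hu => by
    have h1 : IntervalIntegrable u volume (-π) π :=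
      (intervalIntegrable_iff_integrableOn_Ioc_of_le (by linarith [pi_pos])).2
        (hu.integrable one_le_two)
    exact h1.continuousOn_mul (by fun_prop)
  unfold unitaryFourierCoeff
  rw [← mul_sub, ← intervalIntegral.integral_sub (hint hf) (hint hg)]
  simp_rw [Pi.sub_apply, mul_sub]

lemma integral_norm_sq_sub_trigPoly {f : ℝ → ℂ}
    (hf : MemLp f 2 (volume.restrict (Set.Ioc (-π) π))) (s : Finset ℤ) :
    ∫ θ in (-π)..π, ‖f θ - trigPoly s (unitaryFourierCoeff f) θ‖ ^ 2
      = (∫ θ in (-π)..π, ‖f θ‖ ^ 2) - ∑ n ∈ s, ‖unitaryFourierCoeff f n‖ ^ 2 := by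
  have hP := memLp_trigPoly s (unitaryFourierCoeff f)
  have h := hasSum_sq_unitaryFourierCoeff (hf.sub hP)
  have h1 := hasSum_sq_unitaryFourierCoeff hf
  have h2 := hasSum_sq_unitaryFourierCoeff hP
  rw [integral_norm_sq_trigPoly] at h2
  refine h.unique ?_
  convert! h1.sub h2 using 1
  funext n
  rw [unitaryFourierCoeff_sub hf hP, unitaryFourierCoeff_trigPoly]
  split_ifs <;> simp

lemma norm_sq_le_add_eps {z w : ℂ} {ε : ℝ} (hε : 0 < ε) :
    ‖z‖ ^ 2 ≤ (1 + ε) * ‖w‖ ^ 2 + (1 + ε⁻¹) * ‖w - z‖ ^ 2 := by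
  have h1 : ‖z‖ ≤ ‖w‖ + ‖w - z‖ := by
    simpa using norm_sub_le w (w - z)
  have h2 : ‖z‖ ^ 2 ≤ (‖w‖ + ‖w - z‖) ^ 2 := by gcongr
  have h3 : 0 ≤ ε⁻¹ * (ε * ‖w‖ - ‖w - z‖) ^ 2 := by positivity
  have h4 : ε⁻¹ * (ε * ‖w‖ - ‖w - z‖) ^ 2
      = ε * ‖w‖ ^ 2 - 2 * ‖w‖ * ‖w - z‖ + ε⁻¹ * ‖w - z‖ ^ 2 := by
    field_simp
    ring
  linarith

/-- The chordal second moment of a function is approximately continuous in `L²`. -/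
lemma integral_chordal_le_add_eps {f g : ℝ → ℂ}
    (hf : MemLp f 2 (volume.restrict (Set.Ioc (-π) π)))
    (hg : MemLp g 2 (volume.restrict (Set.Ioc (-π) π))) {ε : ℝ} (hε : 0 < ε) :
    ∫ θ in (-π)..π, 2 * (1 - cos θ) * ‖g θ‖ ^ 2
      ≤ (1 + ε) * (∫ θ in (-π)..π, 2 * (1 - cos θ) * ‖f θ‖ ^ 2)
        + 4 * (1 + ε⁻¹) * ∫ θ in (-π)..π, ‖f θ - g θ‖ ^ 2 := by
  have hle : -π ≤ π := by linarith [pi_pos]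
  have hsq : ∀ {u : ℝ → ℂ}, MemLp u 2 (volume.restrict (Set.Ioc (-π) π)) →
      IntervalIntegrable (fun θ => ‖u θ‖ ^ 2) volume (-π) π := fun hu =>
    (intervalIntegrable_iff_integrableOn_Ioc_of_le hle).2
      ((memLp_two_iff_integrable_sq_norm hu.1).1 hu)
  have hw : ∀ {u : ℝ → ℂ}, MemLp u 2 (volume.restrict (Set.Ioc (-π) π)) →
      IntervalIntegrable (fun θ => 2 * (1 - cos θ) * ‖u θ‖ ^ 2) volume (-π) π := fun hu =>
    (hsq hu).continuousOn_mul (by fun_prop)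
  have hsub : IntervalIntegrable (fun θ => ‖f θ - g θ‖ ^ 2) volume (-π) π := hsq (hf.sub hg)
  rw [← intervalIntegral.integral_const_mul, ← intervalIntegral.integral_const_mul,
    ← intervalIntegral.integral_add ((hw hf).const_mul _) (hsub.const_mul _)]
  refine intervalIntegral.integral_mono_on hle (hw hg)
    (((hw hf).const_mul _).add (hsub.const_mul _)) fun θ _ => ?_
  have h1 : 0 ≤ 2 * (1 - cos θ) := by linarith [cos_le_one θ]
  have h2 : 2 * (1 - cos θ) ≤ 4 := by linarith [neg_one_le_cos θ]
  have h3 := mul_le_mul_of_nonneg_left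
    (norm_sq_le_add_eps (z := g θ) (w := f θ) hε) h1
  have h4 := mul_le_mul_of_nonneg_right h2
    (by positivity : 0 ≤ (1 + ε⁻¹) * ‖f θ - g θ‖ ^ 2)
  linarith

/-- Family of linear uncertainty bounds for the pair (standard metric on ℤ, chordal metric on 𝕋)
obtained from the second-order trial function `φ(θ) = exp(a cos θ + b cos²θ)` (eq. (41) of the
paper): for every normalized `ψ ∈ L²([-π,π])` and every `a > 0`,
`∑_n n²|ψ̂(n)|² + [a(8a² + 5a + 2)/(8a + 4)]·∫ 2(1 − cos θ)|ψ(θ)|²dθ ≥ a`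
(with the convention that a divergent series makes the left side infinite). -/
theorem number_chordal_second_order_bound
    (ψ : ℝ → ℂ)
    (hmeas : AEStronglyMeasurable ψ (volume.restrict (Set.Ioc (-π) π)))
    (hnorm : (∫ θ in (-π)..π, ‖ψ θ‖ ^ 2) = 1)
    (ψhat : ℤ → ℂ)
    (hψhat : ∀ n : ℤ, ψhat n
      = (Real.sqrt (2 * π) : ℂ)⁻¹ * ∫ θ in (-π)..π, Complex.exp (-(n : ℂ) * θ * Complex.I) * ψ θ)
    (a : ℝ) (ha : 0 < a) :
    (∑' n : ℤ, ENNReal.ofReal ((n : ℝ) ^ 2 * ‖ψhat n‖ ^ 2))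
        + ENNReal.ofReal ((a * (8 * a ^ 2 + 5 * a + 2) / (8 * a + 4))
            * ∫ θ in (-π)..π, 2 * (1 - Real.cos θ) * ‖ψ θ‖ ^ 2)
      ≥ ENNReal.ofReal a := by
  obtain rfl : ψhat = unitaryFourierCoeff ψ := funext hψhat
  set μ := a * (8 * a ^ 2 + 5 * a + 2) / (8 * a + 4) with hμ
  have hμ0 : 0 ≤ μ := by positivity
  have hle : -π ≤ π := by linarith [pi_pos]
  have hL2 : MemLp ψ 2 (volume.restrict (Set.Ioc (-π) π)) := by
    rw [memLp_two_iff_integrable_sq_norm hmeas]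
    by_contra hni
    rw [intervalIntegral.integral_of_le hle, integral_undef hni] at hnorm
    exact zero_ne_one hnorm
  set W := ∫ θ in (-π)..π, 2 * (1 - Real.cos θ) * ‖ψ θ‖ ^ 2 with hW
  have hW0 : 0 ≤ W := intervalIntegral.integral_nonneg hle fun θ _ =>
    mul_nonneg (by linarith [cos_le_one θ]) (sq_nonneg _)
  rcases eq_or_ne (∑' n : ℤ, ENNReal.ofReal ((n : ℝ) ^ 2 * ‖unitaryFourierCoeff ψ n‖ ^ 2)) ⊤
    with htop | htop
  · simp [htop]
  set E := (∑' n : ℤ, ENNReal.ofReal ((n : ℝ) ^ 2 * ‖unitaryFourierCoeff ψ n‖ ^ 2)).toReal with hE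
  have hsum : ∀ s : Finset ℤ, ∑ n ∈ s, (n : ℝ) ^ 2 * ‖unitaryFourierCoeff ψ n‖ ^ 2 ≤ E := by
    intro s
    rw [hE, ← ENNReal.ofReal_le_iff_le_toReal htop,
      ENNReal.ofReal_sum_of_nonneg fun n _ => by positivity]
    exact ENNReal.sum_le_tsum s
  have hmass := hasSum_sq_unitaryFourierCoeff hL2
  rw [hnorm] at hmass
  have hbound : ∀ ε > 0, a ≤ E + μ * ((1 + ε) * W) := by
    intro ε hε
    have hs : ∀ s : Finset ℤ, a * ∑ n ∈ s, ‖unitaryFourierCoeff ψ n‖ ^ 2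
        ≤ E + μ * ((1 + ε) * W
          + 4 * (1 + ε⁻¹) * (1 - ∑ n ∈ s, ‖unitaryFourierCoeff ψ n‖ ^ 2)) := by
      intro s
      have h1 := second_order_bound_of_hasDerivAt ha
        (hasDerivAt_trigPoly s (unitaryFourierCoeff ψ)) (continuous_trigPoly s _)
      rw [integral_norm_sq_trigPoly, integral_norm_sq_trigPoly, ← hμ] at h1
      have h2 := integral_chordal_le_add_eps hL2 (memLp_trigPoly s (unitaryFourierCoeff ψ)) hε
      rw [integral_norm_sq_sub_trigPoly hL2, hnorm] at h2
      have h3 := mul_le_mul_of_nonneg_left h2 hμ0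
      have h4 : ∑ n ∈ s, ‖(n : ℂ) * Complex.I * unitaryFourierCoeff ψ n‖ ^ 2 ≤ E := by
        refine le_trans (le_of_eq (Finset.sum_congr rfl fun n _ => ?_)) (hsum s)
        simp [mul_pow]
      linarith
    have hlim := le_of_tendsto_of_tendsto' (hmass.const_mul a)
      (((((hmass.const_sub 1).const_mul (4 * (1 + ε⁻¹))).const_add
        ((1 + ε) * W)).const_mul μ).const_add E) hs
    simpa using hlim
  have hfinal : a ≤ E + μ * W := by
    refine le_of_forall_pos_le_add fun δ hδ => ?_
    have h := hbound (δ / (μ * W + 1)) (by positivity)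
    have h5 : δ / (μ * W + 1) * (μ * W) ≤ δ := by
      rw [div_mul_eq_mul_div, div_le_iff₀ (by positivity)]
      nlinarith
    linarith
  rw [← ENNReal.ofReal_toReal htop, ← hE, ge_iff_le,
    ← ENNReal.ofReal_add ENNReal.toReal_nonneg (mul_nonneg hμ0 hW0)]
  exact ENNReal.ofReal_le_ofReal hfinal
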